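/- Suppose 0 < E < T ≤ N, the messages are mutually independent with H(W_k) = L for every k, E-security holds, T-privacy holds, and ε-correctness holds for every message k ∈ [1:K]. Then (1 − E/N) · H(A_{[1:N]}^{[1]} | Q_{[1:N]}^{[1]}) ≥ (L − ε) · Σ_{i=0}^{K−1} ((T−E)/(N−E))^i. (Consequently the ETPIR rate is at most (1 − E/N)·(1 + (T−E)/(N−E) + ⋯ + ((T−E)/(N−E))^{K−1})^{−1} as ε/L → 0.) -/

import Mathlib

open Finset

/-- Probability that the finitely-valued random variable `X` (on the finite
probability space with pmf `p`) takes the value `x`. -/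
noncomputable def prC {Ω α : Type*} [Fintype Ω] [DecidableEq α]
    (p : Ω → ℝ) (X : Ω → α) (x : α) : ℝ :=
  ∑ ω, if X ω = x then p ω else 0

/-- Shannon entropy `H(X)` of a finitely-valued random variable. -/
noncomputable def entH {Ω α : Type*} [Fintype Ω] [Fintype α] [DecidableEq α]
    (p : Ω → ℝ) (X : Ω → α) : ℝ :=
  -∑ x, prC p X x * Real.log (prC p X x)

/-- Conditional entropy `H(X|Y) = H(X,Y) - H(Y)`. -/
noncomputable def condEntH {Ω α β : Type*} [Fintype Ω] [Fintype α] [DecidableEq α]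
    [Fintype β] [DecidableEq β] (p : Ω → ℝ) (X : Ω → α) (Y : Ω → β) : ℝ :=
  entH p (fun ω => (X ω, Y ω)) - entH p Y

/-- Mutual information `I(X;Y) = H(X) + H(Y) - H(X,Y)`. -/
noncomputable def mutInfH {Ω α β : Type*} [Fintype Ω] [Fintype α] [DecidableEq α]
    [Fintype β] [DecidableEq β] (p : Ω → ℝ) (X : Ω → α) (Y : Ω → β) : ℝ :=
  entH p X + entH p Y - entH p (fun ω => (X ω, Y ω))

open scoped Classical in
/-- Total mass of the class of `x` for the equivalence relation `r`. -/
noncomputable def classMass {Ω : Type*} [Fintype Ω] (p : Ω → ℝ) (r : Setoid Ω) (x : Ω) : ℝ :=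
  ∑ y, if r y x then p y else 0

/-- Shannon entropy of the partition of `Ω` into the classes of `r`. -/
noncomputable def partEnt {Ω : Type*} [Fintype Ω] (p : Ω → ℝ) (r : Setoid Ω) : ℝ :=
  -∑ x, p x * Real.log (classMass p r x)

/-- The equivalence relation induced by the subfamily of `X` indexed by `s`. -/
def jointKer {Ω ι α : Type*} (X : ι → Ω → α) (s : Finset ι) : Setoid Ω where
  r x y := ∀ i ∈ s, X i x = X i y
  iseqv := ⟨fun _ _ _ => rfl, fun h i hi => (h i hi).symm,
    fun h h' i hi => (h i hi).trans (h' i hi)⟩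

section JointKer

variable {Ω ι α β : Type*}

theorem jointKer_anti (X : ι → Ω → α) {s t : Finset ι} (h : s ⊆ t) :
    jointKer X t ≤ jointKer X s :=
  fun _ _ hxy i hi => hxy i (h hi)

theorem jointKer_union [DecidableEq ι] (X : ι → Ω → α) (s t : Finset ι) :
    jointKer X (s ∪ t) = jointKer X s ⊓ jointKer X t := by
  ext x y
  change (∀ i ∈ s ∪ t, _) ↔ (∀ i ∈ s, _) ∧ (∀ i ∈ t, _)
  simp only [Finset.mem_union]
  exact ⟨fun h => ⟨fun i hi => h i (.inl hi), fun i hi => h i (.inr hi)⟩,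
    fun h i hi => hi.elim (h.1 i) (h.2 i)⟩

theorem jointKer_singleton (X : ι → Ω → α) (i : ι) :
    jointKer X {i} = Setoid.ker (X i) := by
  ext x y
  change (∀ j ∈ ({i} : Finset ι), _) ↔ X i x = X i y
  simp

theorem jointKer_insert [DecidableEq ι] (X : ι → Ω → α) (i : ι) (s : Finset ι) :
    jointKer X (insert i s) = Setoid.ker (X i) ⊓ jointKer X s := by
  rw [Finset.insert_eq, jointKer_union, jointKer_singleton]

theorem jointKer_empty (X : ι → Ω → α) : jointKer X ∅ = ⊤ := by
  ext x y
  change (∀ i ∈ (∅ : Finset ι), _) ↔ True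
  simp

theorem ker_pi_univ [Fintype ι] (X : ι → Ω → α) :
    Setoid.ker (fun ω i => X i ω) = jointKer X Finset.univ := by
  ext x y
  change ((fun i => X i x) = fun i => X i y) ↔ (∀ i ∈ Finset.univ, _)
  simp [funext_iff]

theorem ker_pi_subtype (X : ι → Ω → α) (s : Finset ι) :
    Setoid.ker (fun ω (i : {x // x ∈ s}) => X i.1 ω) = jointKer X s := by
  ext x y
  change ((fun i : {x // x ∈ s} => X i.1 x) = fun i : {x // x ∈ s} => X i.1 y) ↔ (∀ i ∈ s, _)
  simp [funext_iff]

theorem ker_prodMk (X : Ω → α) (Y : Ω → β) :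
    Setoid.ker (fun ω => (X ω, Y ω)) = Setoid.ker X ⊓ Setoid.ker Y := by
  ext x y
  change (X x, Y x) = (X y, Y y) ↔ X x = X y ∧ Y x = Y y
  simp

end JointKer

section Entropy

variable {Ω α β : Type*} [Fintype Ω] {p : Ω → ℝ}

theorem sum_mul_comp_eq_sum_prC [Fintype α] [DecidableEq α] (X : Ω → α) (g : α → ℝ) :
    ∑ ω, p ω * g (X ω) = ∑ z, prC p X z * g z := by
  simp only [prC, Finset.sum_mul, ite_mul, zero_mul]
  rw [Finset.sum_comm]
  simp

theorem classMass_ker [DecidableEq α] (X : Ω → α) (x : Ω) :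
    classMass p (Setoid.ker X) x = prC p X (X x) := by
  refine Finset.sum_congr rfl fun y _ => ?_
  simp only [Setoid.ker_def]

theorem entH_eq_partEnt [Fintype α] [DecidableEq α] (X : Ω → α) :
    entH p X = partEnt p (Setoid.ker X) := by
  simp only [entH, partEnt, classMass_ker]
  rw [sum_mul_comp_eq_sum_prC X fun z => Real.log (prC p X z)]

theorem condEntH_eq_partEnt [Fintype α] [DecidableEq α] [Fintype β] [DecidableEq β]
    (X : Ω → α) (Y : Ω → β) :
    condEntH p X Y =
      partEnt p (Setoid.ker X ⊓ Setoid.ker Y) - partEnt p (Setoid.ker Y) := by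
  rw [condEntH, entH_eq_partEnt, entH_eq_partEnt, ker_prodMk]

theorem mutInfH_eq_partEnt [Fintype α] [DecidableEq α] [Fintype β] [DecidableEq β]
    (X : Ω → α) (Y : Ω → β) :
    mutInfH p X Y = partEnt p (Setoid.ker X) + partEnt p (Setoid.ker Y)
      - partEnt p (Setoid.ker X ⊓ Setoid.ker Y) := by
  rw [mutInfH, entH_eq_partEnt, entH_eq_partEnt, entH_eq_partEnt, ker_prodMk]

/-- The entropy of a function of a random variable depends only on its distribution. -/
theorem partEnt_ker_comp_congr [Fintype α] [DecidableEq α] {X Y : Ω → α}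
    (h : ∀ z, prC p X z = prC p Y z) (f : α → β) :
    partEnt p (Setoid.ker fun ω => f (X ω)) = partEnt p (Setoid.ker fun ω => f (Y ω)) := by
  classical
  have key (Z : Ω → α) : partEnt p (Setoid.ker fun ω => f (Z ω)) =
      -∑ z, prC p Z z * Real.log (∑ z', prC p Z z' * if f z' = f z then 1 else 0) := by
    rw [← sum_mul_comp_eq_sum_prC Z
      fun z => Real.log (∑ z', prC p Z z' * if f z' = f z then 1 else 0)]
    refine congrArg Neg.neg (Finset.sum_congr rfl fun ω _ => ?_)
    rw [classMass_ker, ← sum_mul_comp_eq_sum_prC Z fun z' => if f z' = f (Z ω) then 1 else 0]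
    simp [prC]
  simp only [key, h]

theorem classMass_nonneg (hp : ∀ ω, 0 ≤ p ω) (r : Setoid Ω) (x : Ω) : 0 ≤ classMass p r x :=
  Finset.sum_nonneg fun y _ => by split_ifs <;> simp [hp]

theorem le_classMass (hp : ∀ ω, 0 ≤ p ω) (r : Setoid Ω) (x : Ω) : p x ≤ classMass p r x := by
  classical
  have h := Finset.single_le_sum (f := fun y => if r y x then p y else 0)
    (fun y _ => by split_ifs <;> simp [hp]) (Finset.mem_univ x)
  simpa only [if_pos (r.refl x), classMass] using h

theorem classMass_mono (hp : ∀ ω, 0 ≤ p ω) {r s : Setoid Ω} (h : r ≤ s) (x : Ω) :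
    classMass p r x ≤ classMass p s x := by
  refine Finset.sum_le_sum fun y _ => ?_
  by_cases hr : r y x
  · simp [hr, h hr]
  · rw [if_neg hr]
    split_ifs <;> simp [hp]

theorem classMass_congr {r : Setoid Ω} {x y : Ω} (h : r x y) :
    classMass p r x = classMass p r y := by
  refine Finset.sum_congr rfl fun z _ => ?_
  have hz : r z x ↔ r z y := ⟨fun h' => r.trans h' h, fun h' => r.trans h' (r.symm h)⟩
  by_cases h' : r z y
  · rw [if_pos h', if_pos (hz.mpr h')]
  · rw [if_neg h', if_neg (mt hz.mp h')]

theorem partEnt_anti (hp : ∀ ω, 0 ≤ p ω) {r s : Setoid Ω} (h : r ≤ s) :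
    partEnt p s ≤ partEnt p r := by
  refine neg_le_neg (Finset.sum_le_sum fun x _ => ?_)
  rcases (hp x).eq_or_lt with h0 | h0
  · simp [← h0]
  · exact mul_le_mul_of_nonneg_left
      (Real.log_le_log (h0.trans_le (le_classMass hp r x)) (classMass_mono hp h x)) h0.le

theorem partEnt_top (hp1 : ∑ ω, p ω = 1) : partEnt p ⊤ = 0 := by
  have h (x : Ω) : classMass p ⊤ x = 1 := by
    rw [← hp1]
    exact Finset.sum_congr rfl fun y _ => if_pos trivial
  simp [partEnt, h]

theorem sum_div_classMass_le_one (hp : ∀ ω, 0 ≤ p ω) (hp1 : ∑ ω, p ω = 1) {a b c : Setoid Ω}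
    (hac : a ≤ c) (hbc : b ≤ c) :
    ∑ x, p x * (classMass p a x * classMass p b x / (classMass p (a ⊓ b) x * classMass p c x))
      ≤ 1 := by
  classical
  have inner (u v : Ω) : ∑ x, (if a u x ∧ b v x then p x / classMass p (a ⊓ b) x else 0) ≤ 1 := by
    by_cases hx : ∃ x₀, a u x₀ ∧ b v x₀
    · obtain ⟨x₀, ha, hb⟩ := hx
      calc ∑ x, (if a u x ∧ b v x then p x / classMass p (a ⊓ b) x else 0)
          = ∑ x, (if (a ⊓ b) x x₀ then p x else 0) / classMass p (a ⊓ b) x₀ := by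
            refine Finset.sum_congr rfl fun x _ => ?_
            have : (a u x ∧ b v x) ↔ (a ⊓ b) x x₀ :=
              ⟨fun h => ⟨a.trans (a.symm h.1) ha, b.trans (b.symm h.2) hb⟩,
                fun h => ⟨a.trans ha (a.symm h.1), b.trans hb (b.symm h.2)⟩⟩
            simp only [this]
            split_ifs with h
            · rw [classMass_congr h]
            · simp
        _ = classMass p (a ⊓ b) x₀ / classMass p (a ⊓ b) x₀ := by
            rw [← Finset.sum_div]
            rfl
        _ ≤ 1 := div_self_le_one _
    · push Not at hx
      refine (Finset.sum_eq_zero fun x _ => if_neg fun h => hx x h.1 h.2).le.trans zero_le_one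
  calc ∑ x, p x * (classMass p a x * classMass p b x / (classMass p (a ⊓ b) x * classMass p c x))
      = ∑ x, ∑ u, ∑ v, if a u x ∧ b v x then
          p u * p v * (p x / classMass p (a ⊓ b) x) / classMass p c x else 0 := by
        refine Finset.sum_congr rfl fun x _ => ?_
        have : p x * (classMass p a x * classMass p b x /
            (classMass p (a ⊓ b) x * classMass p c x)) =
            classMass p a x * classMass p b x *
              (p x / classMass p (a ⊓ b) x / classMass p c x) := by
          rw [div_div]; ring
        rw [this]
        nth_rewrite 1 [classMass]
        nth_rewrite 1 [classMass]
        rw [Finset.sum_mul_sum, Finset.sum_mul]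
        refine Finset.sum_congr rfl fun u _ => ?_
        rw [Finset.sum_mul]
        refine Finset.sum_congr rfl fun v _ => ?_
        by_cases h1 : a u x <;> by_cases h2 : b v x <;> simp [h1, h2]
        ring
    _ = ∑ u, ∑ v, ∑ x, if a u x ∧ b v x then
          p u * p v * (p x / classMass p (a ⊓ b) x) / classMass p c x else 0 := by
        rw [Finset.sum_comm]
        exact Finset.sum_congr rfl fun u _ => Finset.sum_comm
    _ ≤ ∑ u, ∑ v, if c v u then p u * p v / classMass p c u else 0 := by
        refine Finset.sum_le_sum fun u _ => Finset.sum_le_sum fun v _ => ?_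
        by_cases hc : c v u
        · rw [if_pos hc]
          calc _ = p u * p v / classMass p c u *
                ∑ x, (if a u x ∧ b v x then p x / classMass p (a ⊓ b) x else 0) := by
                rw [Finset.mul_sum]
                refine Finset.sum_congr rfl fun x _ => ?_
                split_ifs with h
                · rw [classMass_congr (hac h.1)]
                  ring
                · simp
            _ ≤ p u * p v / classMass p c u * 1 :=
                mul_le_mul_of_nonneg_left (inner u v)
                  (div_nonneg (mul_nonneg (hp u) (hp v)) (classMass_nonneg hp c u))
            _ = _ := mul_one _
        · rw [if_neg hc]
          exact (Finset.sum_eq_zero fun x _ => if_neg fun h =>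
            hc (c.trans (hbc h.2) (c.symm (hac h.1)))).le
    _ = ∑ u, p u * (classMass p c u / classMass p c u) := by
        refine Finset.sum_congr rfl fun u _ => ?_
        nth_rewrite 2 [classMass]
        rw [Finset.sum_div, Finset.mul_sum]
        refine Finset.sum_congr rfl fun v _ => ?_
        split_ifs
        · ring
        · simp
    _ ≤ ∑ u, p u := Finset.sum_le_sum fun u _ =>
        mul_le_of_le_one_right (hp u) (div_self_le_one _)
    _ = 1 := hp1

/-- Submodularity of entropy. -/
theorem partEnt_submodular (hp : ∀ ω, 0 ≤ p ω) (hp1 : ∑ ω, p ω = 1) {a b c d : Setoid Ω}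
    (hd : a ⊓ b ≤ d) (hac : a ≤ c) (hbc : b ≤ c) :
    partEnt p d + partEnt p c ≤ partEnt p a + partEnt p b := by
  have key : partEnt p (a ⊓ b) + partEnt p c - partEnt p a - partEnt p b ≤
      ∑ x, (p x * (classMass p a x * classMass p b x /
        (classMass p (a ⊓ b) x * classMass p c x)) - p x) := by
    calc _ = ∑ x, p x * (Real.log (classMass p a x) + Real.log (classMass p b x)
          - Real.log (classMass p (a ⊓ b) x) - Real.log (classMass p c x)) := by
          simp only [partEnt, mul_sub, mul_add, Finset.sum_sub_distrib, Finset.sum_add_distrib]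
          ring
      _ ≤ _ := by
          refine Finset.sum_le_sum fun x _ => ?_
          rcases (hp x).eq_or_lt with h0 | h0
          · simp [← h0]
          have pos (r : Setoid Ω) : 0 < classMass p r x := h0.trans_le (le_classMass hp r x)
          have hlog := Real.log_le_sub_one_of_pos
            (div_pos (mul_pos (pos a) (pos b)) (mul_pos (pos (a ⊓ b)) (pos c)))
          rw [Real.log_div (mul_pos (pos a) (pos b)).ne' (mul_pos (pos (a ⊓ b)) (pos c)).ne',
            Real.log_mul (pos a).ne' (pos b).ne', Real.log_mul (pos (a ⊓ b)).ne' (pos c).ne'] at hlog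
          have := mul_le_mul_of_nonneg_left hlog h0.le
          linarith
  rw [Finset.sum_sub_distrib, hp1] at key
  linarith [sum_div_classMass_le_one hp hp1 hac hbc, partEnt_anti hp hd]

theorem partEnt_subadditive (hp : ∀ ω, 0 ≤ p ω) (hp1 : ∑ ω, p ω = 1) {a b d : Setoid Ω}
    (hd : a ⊓ b ≤ d) : partEnt p d ≤ partEnt p a + partEnt p b := by
  have := partEnt_submodular hp hp1 hd (le_top : a ≤ ⊤) (le_top : b ≤ ⊤)
  rwa [partEnt_top hp1, add_zero] at this

/-- Independence passes to coarser partitions. -/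
theorem partEnt_add_le_of_le (hp : ∀ ω, 0 ≤ p ω) (hp1 : ∑ ω, p ω = 1) {a b b' : Setoid Ω}
    (h : partEnt p a + partEnt p b ≤ partEnt p (a ⊓ b)) (hb : b ≤ b') :
    partEnt p a + partEnt p b' ≤ partEnt p (a ⊓ b') := by
  have := partEnt_submodular hp hp1 (a := a ⊓ b') (b := b) (c := b') (d := a ⊓ b)
    (inf_le_inf_right b inf_le_left) inf_le_right hb
  linarith

theorem partEnt_jointKer_of_indep {κ : Type*} [Fintype κ] [Fintype α] [DecidableEq α]
    [DecidableEq κ] (hp : ∀ ω, 0 ≤ p ω) (hp1 : ∑ ω, p ω = 1) (W : κ → Ω → α) {L : ℝ}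
    (hind : ∀ w : κ → α, prC p (fun ω k => W k ω) w = ∏ k, prC p (W k) (w k))
    (hW : ∀ k, entH p (W k) = L) (s : Finset κ) :
    partEnt p (jointKer W s) = s.card * L := by
  have hle (t : Finset κ) : partEnt p (jointKer W t) ≤ t.card * L := by
    induction t using Finset.induction_on with
    | empty => simp [jointKer_empty, partEnt_top hp1]
    | insert i t hi ih =>
      have := partEnt_subadditive hp hp1 (jointKer_insert W i t).ge
      rw [← entH_eq_partEnt, hW] at this
      rw [Finset.card_insert_of_notMem hi]
      push_cast
      linarith
  have huniv : partEnt p (jointKer W Finset.univ) = Fintype.card κ * L := by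
    have h1 : ∑ k, entH p (W k) = Fintype.card κ * L := by simp [hW]
    rw [← h1]
    simp only [entH_eq_partEnt, partEnt]
    rw [Finset.sum_neg_distrib, Finset.sum_comm]
    refine congrArg Neg.neg (Finset.sum_congr rfl fun ω _ => ?_)
    rw [← ker_pi_univ, classMass_ker, hind, ← Finset.mul_sum]
    rcases (hp ω).eq_or_lt with h0 | h0
    · simp [← h0]
    · rw [Real.log_prod fun k _ => ?_]
      · simp only [classMass_ker]
      · rw [← classMass_ker]
        exact (h0.trans_le (le_classMass hp _ ω)).ne'
  refine (hle s).antisymm ?_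
  have h1 := partEnt_subadditive hp hp1 (jointKer_union W s sᶜ).ge
  rw [Finset.union_compl, huniv] at h1
  have h2 := hle sᶜ
  have h3 : ((s.card : ℝ) + (sᶜ).card) = Fintype.card κ := by
    exact_mod_cast s.card_add_card_compl
  rw [← h3] at h1
  linarith

/-- If each `A i` is almost surely a function of `Q i` and `x`, then the same holds for
subfamilies. -/
theorem partEnt_jointKer_inf_le {ι : Type*} [DecidableEq ι] (hp : ∀ ω, 0 ≤ p ω)
    (hp1 : ∑ ω, p ω = 1) (A : ι → Ω → α) (Q : ι → Ω → β) (x : Setoid Ω)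
    (hA : ∀ i, partEnt p (Setoid.ker (A i) ⊓ (Setoid.ker (Q i) ⊓ x)) ≤
      partEnt p (Setoid.ker (Q i) ⊓ x)) (s : Finset ι) :
    partEnt p (jointKer A s ⊓ (x ⊓ jointKer Q s)) ≤ partEnt p (x ⊓ jointKer Q s) := by
  induction s using Finset.induction_on with
  | empty => simp [jointKer_empty]
  | insert i s hi ih =>
    rw [jointKer_insert, jointKer_insert]
    have h1 := partEnt_submodular hp hp1
      (a := Setoid.ker (A i) ⊓ (Setoid.ker (Q i) ⊓ x))
      (b := Setoid.ker (Q i) ⊓ (jointKer A s ⊓ (x ⊓ jointKer Q s)))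
      (c := Setoid.ker (Q i) ⊓ x)
      (d := Setoid.ker (A i) ⊓ jointKer A s ⊓ (x ⊓ (Setoid.ker (Q i) ⊓ jointKer Q s)))
      (fun _ _ h => ⟨⟨h.1.1, h.2.2.1⟩, h.1.2.2, h.2.1, h.2.2.2.2⟩)
      (fun _ _ h => h.2) (fun _ _ h => ⟨h.1, h.2.2.1⟩)
    have h2 := partEnt_submodular hp hp1
      (a := jointKer A s ⊓ (x ⊓ jointKer Q s))
      (b := x ⊓ (Setoid.ker (Q i) ⊓ jointKer Q s))
      (c := x ⊓ jointKer Q s)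
      (d := Setoid.ker (Q i) ⊓ (jointKer A s ⊓ (x ⊓ jointKer Q s)))
      (fun _ _ h => ⟨h.2.2.1, h.1⟩) (fun _ _ h => h.2) (fun _ _ h => ⟨h.1, h.2.2⟩)
    linarith [hA i]

/-- If `a` is almost surely a function of `x` and `q'`, and `x` is independent of the refinement
`q` of `q'`, then a function `y` of `a` and `x` depends on `q` only through `q'`. -/
theorem partEnt_inf_sub_le_of_indep (hp : ∀ ω, 0 ≤ p ω) (hp1 : ∑ ω, p ω = 1)
    {a x y q q' : Setoid Ω} (hq : q ≤ q')
    (ha : partEnt p (a ⊓ (x ⊓ q')) ≤ partEnt p (x ⊓ q'))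
    (hx : partEnt p x + partEnt p q ≤ partEnt p (x ⊓ q)) (hy : a ⊓ x ≤ y) :
    partEnt p (y ⊓ q') - partEnt p q' ≤ partEnt p (y ⊓ q) - partEnt p q := by
  have h1 := partEnt_submodular hp hp1 (a := y ⊓ q) (b := a ⊓ (x ⊓ q')) (c := y ⊓ q')
    (d := a ⊓ (x ⊓ q)) (fun _ _ h => ⟨h.2.1, h.2.2.1, h.1.2⟩) (inf_le_inf_left y hq)
    (fun _ _ h => ⟨hy ⟨h.1, h.2.1⟩, h.2.2⟩)
  have h2 := partEnt_anti hp (r := a ⊓ (x ⊓ q)) (s := x ⊓ q) inf_le_right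
  have h3 := partEnt_subadditive hp hp1 (a := x) (b := q') le_rfl
  linarith

end Entropy

theorem sub_le_sum_insert_sub {ι : Type*} [DecidableEq ι] {f : Finset ι → ℝ}
    (hf : ∀ s t, f (s ∪ t) + f (s ∩ t) ≤ f s + f t) (s : Finset ι) (r : Finset ι) (hr : Disjoint s r) :
    f (s ∪ r) - f s ≤ ∑ x ∈ r, (f (insert x s) - f s) := by
  induction r using Finset.induction_on with
  | empty => simp
  | insert x r hx ih =>
    rw [Finset.sum_insert hx]
    rw [Finset.disjoint_insert_right] at hr
    have h := hf (insert x s) (s ∪ r)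
    have e1 : insert x s ∪ (s ∪ r) = s ∪ insert x r := by
      ext; simp only [Finset.mem_union, Finset.mem_insert]; tauto
    have e2 : insert x s ∩ (s ∪ r) = s := by
      ext y
      simp only [Finset.mem_union, Finset.mem_insert, Finset.mem_inter]
      constructor
      · rintro ⟨rfl | h, h' | h'⟩ <;> first | assumption | exact absurd h' hx
      · exact fun h => ⟨.inr h, .inl h⟩
    rw [e1, e2] at h
    linarith [ih hr.2]

/-- A form of Han's inequality: a submodular function has a large value on some set of each
prescribed size above a given set. -/
theorem exists_superset_card_of_submodular {ι : Type*} [Fintype ι] [DecidableEq ι]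
    {f : Finset ι → ℝ} (hf : ∀ s t, f (s ∪ t) + f (s ∩ t) ≤ f s + f t) (s : Finset ι) {m : ℕ}
    (hsm : s.card ≤ m) (hm : m ≤ Fintype.card ι) :
    ∃ t, s ⊆ t ∧ t.card = m ∧
      ((Fintype.card ι : ℝ) - s.card) * (f Finset.univ - f t) ≤
        ((Fintype.card ι : ℝ) - m) * (f Finset.univ - f s) := by
  induction m, hsm using Nat.le_induction with
  | base => exact ⟨s, subset_rfl, rfl, le_rfl⟩
  | succ m hsm ih =>
    obtain ⟨t, hst, htm, hle⟩ := ih (by lia)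
    have hsum := sub_le_sum_insert_sub hf t tᶜ disjoint_compl_right
    rw [Finset.union_compl] at hsum
    have hcard : ((tᶜ).card : ℝ) = Fintype.card ι - m := by
      rw [Finset.card_compl, htm, Nat.cast_sub (by lia)]
    have hpos : (0 : ℝ) < Fintype.card ι - m := by
      rw [sub_pos]; exact_mod_cast hm
    have hne : (tᶜ).Nonempty := by
      rw [← Finset.card_pos, ← Nat.cast_pos (α := ℝ), hcard]; exact hpos
    obtain ⟨x, hx, hxle⟩ := Finset.exists_le_of_sum_le hne
      (f := fun _ => (f Finset.univ - f t) / (Fintype.card ι - m))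
      (g := fun x => f (insert x t) - f t) (by
        rw [Finset.sum_const, nsmul_eq_mul, hcard, mul_div_cancel₀ _ hpos.ne']
        exact hsum)
    refine ⟨insert x t, hst.trans (Finset.subset_insert x t), ?_, ?_⟩
    · rw [Finset.card_insert_of_notMem (Finset.mem_compl.mp hx), htm]
    · rw [div_le_iff₀ hpos] at hxle
      have hs : (0 : ℝ) ≤ Fintype.card ι - s.card := by
        rw [sub_nonneg]; exact_mod_cast s.card_le_univ
      have hm' : (0 : ℝ) ≤ Fintype.card ι - (m + 1) := by
        rw [sub_nonneg]; exact_mod_cast hm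
      push_cast
      refine le_of_mul_le_mul_left ?_ hpos
      have h1 := mul_le_mul_of_nonneg_left hxle hs
      have h2 := mul_le_mul_of_nonneg_left hle hm'
      nlinarith

theorem partEnt_jointKer_inf_submodular {Ω α ι : Type*} [Fintype Ω] [DecidableEq ι] {p : Ω → ℝ}
    (hp : ∀ ω, 0 ≤ p ω) (hp1 : ∑ ω, p ω = 1) (X : ι → Ω → α) (c : Setoid Ω) (s t : Finset ι) :
    partEnt p (jointKer X (s ∪ t) ⊓ c) + partEnt p (jointKer X (s ∩ t) ⊓ c) ≤
      partEnt p (jointKer X s ⊓ c) + partEnt p (jointKer X t ⊓ c) := by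
  refine partEnt_submodular hp hp1 ?_
    (inf_le_inf_right c (jointKer_anti X Finset.inter_subset_left))
    (inf_le_inf_right c (jointKer_anti X Finset.inter_subset_right))
  rw [jointKer_union]
  exact fun _ _ h => ⟨⟨h.1.1, h.2.1⟩, h.1.2⟩

/-- Converse bound on the rate of ETPIR when `E < T` (Section 6.1 of the
paper): `(1 - E/N) · H(A_{[1:N]}^{[1]} | Q_{[1:N]}^{[1]})
≥ (L - ε) · (1 + (T-E)/(N-E) + ⋯ + ((T-E)/(N-E))^{K-1})`. -/
theorem stmt_3
    {Ω 𝕎 𝔹 𝔸 𝕊 : Type} [Fintype Ω] [Fintype 𝕎] [DecidableEq 𝕎]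
    [Fintype 𝔹] [DecidableEq 𝔹] [Fintype 𝔸] [DecidableEq 𝔸]
    [Fintype 𝕊] [DecidableEq 𝕊]
    {K N E T : ℕ} (hK : 0 < K) (hE : 0 < E) (hET : E < T) (hTN : T ≤ N)
    (p : Ω → ℝ) (hp0 : ∀ ω, 0 ≤ p ω) (hp1 : ∑ ω, p ω = 1)
    (W : Fin K → Ω → 𝕎) (Q : Fin N → Fin K → Ω → 𝔹)
    (A : Fin N → Fin K → Ω → 𝔸) (S : Ω → 𝕊)
    (L ε : ℝ)
    -- (i) the queries are independent of the messages
    (hQW : mutInfH p (fun ω (n : Fin N) (k : Fin K) => Q n k ω) (fun ω k => W k ω) = 0)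
    -- (ii) the common randomness is independent of the messages and queries
    (hS : mutInfH p S
      (fun ω => ((fun k => W k ω), (fun (n : Fin N) (k : Fin K) => Q n k ω))) = 0)
    -- (iii) the answers are deterministic functions of query, messages and `S`
    (hA : ∀ (n : Fin N) (k : Fin K),
      condEntH p (A n k) (fun ω => (Q n k ω, (fun j => W j ω), S ω)) = 0)
    -- the messages are mutually independent
    (hind : ∀ w : Fin K → 𝕎,
      prC p (fun ω k => W k ω) w = ∏ k, prC p (W k) (w k))
    -- each message has entropy `L`
    (hW : ∀ k : Fin K, entH p (W k) = L)
    -- E-security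
    (hsec : ∀ ℰ : Finset (Fin N), ℰ.card = E → ∀ k : Fin K,
      mutInfH p (fun ω j => W j ω)
        (fun ω => ((fun (n : {x // x ∈ ℰ}) => A n.1 k ω),
                   (fun (n : {x // x ∈ ℰ}) => Q n.1 k ω))) = 0)
    -- T-privacy
    (hpriv : ∀ 𝒯 : Finset (Fin N), 𝒯.card = T → ∀ k k' : Fin K,
      ∀ z, prC p (fun ω => ((fun (n : {x // x ∈ 𝒯}) => A n.1 k ω),
                            (fun (n : {x // x ∈ 𝒯}) => Q n.1 k ω),
                            (fun j => W j ω), S ω)) z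
         = prC p (fun ω => ((fun (n : {x // x ∈ 𝒯}) => A n.1 k' ω),
                            (fun (n : {x // x ∈ 𝒯}) => Q n.1 k' ω),
                            (fun j => W j ω), S ω)) z)
    -- ε-correctness for every message
    (hcor : ∀ k : Fin K, condEntH p (W k)
      (fun ω => ((fun (n : Fin N) => A n k ω),
                 (fun (n : Fin N) => Q n k ω))) ≤ ε) :
    (1 - (E : ℝ) / N) *
        condEntH p (fun ω (n : Fin N) => A n ⟨0, hK⟩ ω)
          (fun ω (n : Fin N) => Q n ⟨0, hK⟩ ω)
      ≥ (L - ε) * ∑ i ∈ Finset.range K, (((T : ℝ) - E) / ((N : ℝ) - E)) ^ i := by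
  have hN : (0 : ℝ) < (N : ℝ) - E := by
    rw [sub_pos]; exact_mod_cast hET.trans_le hTN
  have hN0 : (0 : ℝ) < N := by exact_mod_cast (hE.trans hET).trans_le hTN
  set ρ : ℝ := ((T : ℝ) - E) / ((N : ℝ) - E) with hρ
  have hρ0 : 0 ≤ ρ := div_nonneg (by rw [sub_nonneg]; exact_mod_cast hET.le) hN.le
  set a : Fin K → Finset (Fin N) → Setoid Ω := fun k => jointKer fun n => A n k
  set q : Fin K → Finset (Fin N) → Setoid Ω := fun k => jointKer fun n => Q n k
  set w : ℕ → Setoid Ω := fun m => jointKer W {j | j.val < m} with hw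
  set x : Setoid Ω := jointKer W univ ⊓ Setoid.ker S
  have w_zero : w 0 = ⊤ := by simp [hw, jointKer_empty]
  have w_succ (k : Fin K) : w (k.val + 1) = Setoid.ker (W k) ⊓ w k.val := by
    simp only [hw]
    rw [← jointKer_insert]
    congr 1
    ext j
    simp only [mem_filter, mem_univ, true_and, mem_insert, Fin.ext_iff]
    lia
  have w_ent (k : Fin K) : partEnt p (w (k.val + 1)) = partEnt p (w k.val) + L := by
    have hcard : #{j : Fin K | j.val < k.val + 1} = #{j : Fin K | j.val < k.val} + 1 := by
      rw [← card_insert_of_notMem (a := k) (by simp)]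
      congr 1
      ext j
      simp only [mem_filter, mem_univ, true_and, mem_insert, Fin.ext_iff]
      lia
    simp only [hw]
    rw [partEnt_jointKer_of_indep hp0 hp1 W hind hW, partEnt_jointKer_of_indep hp0 hp1 W hind hW,
      hcard]
    push_cast
    ring
  have x_le_w (m : ℕ) : x ≤ w m := fun _ _ h => jointKer_anti W (subset_univ _) h.1
  have indep (k : Fin K) (s : Finset (Fin N)) :
      partEnt p x + partEnt p (q k s) ≤ partEnt p (x ⊓ q k s) := by
    rw [mutInfH_eq_partEnt, ker_pi_univ W] at hQW
    rw [mutInfH_eq_partEnt, ker_prodMk, ker_pi_univ W] at hS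
    set qq := Setoid.ker fun ω (n : Fin N) (k : Fin K) => Q n k ω
    have h1 := partEnt_subadditive hp0 hp1 (a := jointKer W univ) (b := Setoid.ker S) (d := x) le_rfl
    have h2 := partEnt_anti hp0 (r := x ⊓ qq) (s := Setoid.ker S ⊓ (jointKer W univ ⊓ qq))
      (fun _ _ h => ⟨h.1.2, h.1.1, h.2⟩)
    rw [inf_comm qq] at hQW
    refine partEnt_add_le_of_le hp0 hp1 (b := qq) (by linarith) ?_
    intro y z h n _
    exact congrFun (congrFun h n) k
  have determined (k : Fin K) (s : Finset (Fin N)) :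
      partEnt p (a k s ⊓ (x ⊓ q k s)) ≤ partEnt p (x ⊓ q k s) := by
    refine partEnt_jointKer_inf_le hp0 hp1 _ _ x (fun n => ?_) s
    have := hA n k
    rw [condEntH_eq_partEnt, ker_prodMk, ker_prodMk, ker_pi_univ] at this
    exact (sub_eq_zero.mp this).le
  have local_query (k : Fin K) (s : Finset (Fin N)) (m : ℕ) :
      partEnt p (a k s ⊓ w m ⊓ q k s) - partEnt p (q k s) ≤
        partEnt p (a k s ⊓ w m ⊓ q k univ) - partEnt p (q k univ) :=
    partEnt_inf_sub_le_of_indep hp0 hp1 (jointKer_anti _ (subset_univ s)) (determined k s)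
      (indep k univ) (inf_le_inf_left _ (x_le_w m))
  have secure (ℰ : Finset (Fin N)) (hℰ : #ℰ = E) (k : Fin K) (m : ℕ) :
      partEnt p (w m) + partEnt p (a k ℰ ⊓ q k univ) ≤ partEnt p (a k ℰ ⊓ w m ⊓ q k univ) := by
    have h1 := hsec ℰ hℰ k
    rw [mutInfH_eq_partEnt, ker_prodMk, ker_pi_univ, ker_pi_subtype (fun n => A n k),
      ker_pi_subtype (fun n => Q n k)] at h1
    have h2 : partEnt p (a k ℰ ⊓ q k ℰ) + partEnt p (w m) ≤
        partEnt p (a k ℰ ⊓ q k ℰ ⊓ w m) := by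
      refine partEnt_add_le_of_le hp0 hp1 (b := jointKer W univ) ?_ (jointKer_anti W (subset_univ _))
      rw [inf_comm _ (jointKer W univ)]
      linarith
    have h3 := local_query k ℰ m
    rw [inf_right_comm] at h2
    have h4 := partEnt_submodular hp0 hp1 (a := a k ℰ ⊓ q k ℰ) (b := q k univ) (c := q k ℰ)
      (d := a k ℰ ⊓ q k univ) (fun _ _ h => ⟨h.1.1, h.2⟩) inf_le_right
      (jointKer_anti _ (subset_univ _))
    linarith
  -- the entropy of all answers given the answers seen by `ℰ`, the first `m` messages and the queries
  set B : Finset (Fin N) → Fin K → ℕ → ℝ := fun ℰ k m =>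
    partEnt p (a k univ ⊓ (w m ⊓ q k univ)) - partEnt p (a k ℰ ⊓ (w m ⊓ q k univ)) with hB
  have decode (ℰ : Finset (Fin N)) (hℰ : #ℰ = E) (k : Fin K) :
      L - ε + B ℰ k (k.val + 1) ≤ B ℰ k k.val := by
    have h1 := secure ℰ hℰ k (k.val + 1)
    have h2 := hcor k
    rw [condEntH_eq_partEnt, ker_prodMk, ker_pi_univ, ker_pi_univ] at h2
    have h3 := partEnt_submodular hp0 hp1 (a := Setoid.ker (W k) ⊓ (a k univ ⊓ q k univ))
      (b := a k univ ⊓ (w k.val ⊓ q k univ)) (c := a k univ ⊓ q k univ)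
      (d := a k univ ⊓ (w (k.val + 1) ⊓ q k univ)) (by
        rw [w_succ]
        exact fun _ _ h => ⟨h.2.1, ⟨h.1.1, h.2.2.1⟩, h.2.2.2⟩)
      inf_le_right (fun _ _ h => ⟨h.1, h.2.2⟩)
    have h4 := partEnt_subadditive hp0 hp1 (a := w k.val) (b := a k ℰ ⊓ q k univ)
      (d := a k ℰ ⊓ (w k.val ⊓ q k univ)) (fun _ _ h => ⟨h.2.1, h.1, h.2.2⟩)
    have h5 := w_ent k
    rw [inf_assoc] at h1
    simp only [hB]
    linarith
  have privacy (𝒯 : Finset (Fin N)) (h𝒯 : #𝒯 = T) (s : Finset (Fin N)) (hs : s ⊆ 𝒯)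
      (k k' : Fin K) (m : ℕ) :
      partEnt p (a k s ⊓ w m ⊓ q k 𝒯) = partEnt p (a k' s ⊓ w m ⊓ q k' 𝒯) := by
    have h := partEnt_ker_comp_congr (hpriv 𝒯 h𝒯 k k') fun z =>
      (((fun n : {n // n ∈ s} => z.1 ⟨n.1, hs n.2⟩),
        fun j : {j // j ∈ ({j | j.val < m} : Finset (Fin K))} => z.2.2.1 j.1), z.2.1)
    rw [ker_prodMk, ker_prodMk, ker_prodMk, ker_prodMk, ker_pi_subtype (fun n => A n k),
      ker_pi_subtype (fun n => A n k'), ker_pi_subtype (fun n => Q n k),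
      ker_pi_subtype (fun n => Q n k'), ker_pi_subtype W] at h
    exact h
  have switch (ℰ : Finset (Fin N)) (hℰ : #ℰ = E) (k k' : Fin K) (m : ℕ) :
      ρ * B ℰ k' m ≤ B ℰ k m := by
    obtain ⟨𝒯, hℰ𝒯, h𝒯, hle⟩ := exists_superset_card_of_submodular
      (f := fun s => partEnt p (a k' s ⊓ (w m ⊓ q k' univ)))
      (partEnt_jointKer_inf_submodular hp0 hp1 (fun n => A n k') (w m ⊓ q k' univ)) ℰ (m := T)
      (by lia) (by simpa using hTN)
    rw [Fintype.card_fin, hℰ] at hle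
    have hgain : ρ * B ℰ k' m ≤ partEnt p (a k' 𝒯 ⊓ w m ⊓ q k' univ) -
        partEnt p (a k' ℰ ⊓ w m ⊓ q k' univ) := by
      rw [hρ, div_mul_eq_mul_div, div_le_iff₀ hN, inf_assoc, inf_assoc]
      simp only [hB]
      linarith
    have h1 := partEnt_submodular hp0 hp1 (a := a k' 𝒯 ⊓ w m ⊓ q k' 𝒯)
      (b := a k' ℰ ⊓ w m ⊓ q k' univ) (c := a k' ℰ ⊓ w m ⊓ q k' 𝒯)
      (d := a k' 𝒯 ⊓ w m ⊓ q k' univ) (fun _ _ h => ⟨h.1.1, h.2.2⟩)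
      (fun _ _ h => ⟨⟨jointKer_anti _ hℰ𝒯 h.1.1, h.1.2⟩, h.2⟩)
      (inf_le_inf_left _ (jointKer_anti _ (subset_univ _)))
    have h2 := privacy 𝒯 h𝒯 𝒯 subset_rfl k k' m
    have h3 := privacy 𝒯 h𝒯 ℰ hℰ𝒯 k k' m
    have h4 := local_query k 𝒯 m
    have h5 := partEnt_submodular hp0 hp1 (a := a k ℰ ⊓ w m ⊓ q k 𝒯) (b := q k univ)
      (c := q k 𝒯) (d := a k ℰ ⊓ w m ⊓ q k univ) (fun _ _ h => ⟨h.1.1, h.2⟩) inf_le_right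
      (jointKer_anti _ (subset_univ _))
    have h6 := partEnt_anti hp0 (r := a k univ ⊓ (w m ⊓ q k univ))
      (s := a k 𝒯 ⊓ w m ⊓ q k univ)
      (fun _ _ h => ⟨⟨jointKer_anti _ (subset_univ _) h.1, h.2.1⟩, h.2.2⟩)
    have h7 : B ℰ k m = partEnt p (a k univ ⊓ (w m ⊓ q k univ)) -
        partEnt p (a k ℰ ⊓ w m ⊓ q k univ) := by
      rw [inf_assoc]
    linarith
  have main (ℰ : Finset (Fin N)) (hℰ : #ℰ = E) (d : ℕ) : ∀ k : Fin K, k.val + d + 1 = K →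
      (L - ε) * ∑ i ∈ range (d + 1), ρ ^ i ≤ B ℰ k k.val := by
    induction d with
    | zero =>
      intro k _
      have h1 := decode ℰ hℰ k
      have h2 : 0 ≤ B ℰ k (k.val + 1) := sub_nonneg.mpr
        (partEnt_anti hp0 (inf_le_inf_right _ (jointKer_anti _ (subset_univ _))))
      simp only [zero_add, sum_range_one, pow_zero]
      linarith
    | succ d ih =>
      intro k hk
      have h1 := decode ℰ hℰ k
      have h2 := switch ℰ hℰ k ⟨k.val + 1, by lia⟩ (k.val + 1)
      have h3 := mul_le_mul_of_nonneg_left (ih ⟨k.val + 1, by lia⟩ (by simp only; lia)) hρ0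
      rw [geom_sum_succ]
      linarith
  obtain ⟨ℰ, -, hℰ, hle⟩ := exists_superset_card_of_submodular
    (f := fun s => partEnt p (a ⟨0, hK⟩ s ⊓ q ⟨0, hK⟩ univ))
    (partEnt_jointKer_inf_submodular hp0 hp1 (fun n => A n ⟨0, hK⟩) (q ⟨0, hK⟩ univ)) ∅ (m := E)
    (by simp) (by simpa using hET.le.trans hTN)
  rw [Fintype.card_fin, card_empty, show a ⟨0, hK⟩ ∅ = ⊤ from jointKer_empty _,
    top_inf_eq] at hle
  have h := main ℰ hℰ (K - 1) ⟨0, hK⟩ (by simp only; lia)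
  rw [Nat.sub_add_cancel hK] at h
  simp only [hB, w_zero, top_inf_eq] at h
  rw [condEntH_eq_partEnt, ker_pi_univ (fun n => A n ⟨0, hK⟩), ker_pi_univ (fun n => Q n ⟨0, hK⟩)]
  refine h.trans ?_
  rw [one_sub_div hN0.ne', div_mul_eq_mul_div, le_div_iff₀ hN0]
  simp only [Nat.cast_zero, sub_zero] at hle
  linarith
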